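/- Define τ : (a_h, b_h) → ℝ by τ(v) = −p_v ln p_v − (1−p_v) ln(1−p_v) for v ≤ 0 and τ(v) = ln 2 for v ≥ 0, where p_v = ((2v+h²)^{1/2} − h + 1)/2, h > 0, a_h = −h²/2 if h ≤ 1 and a_h = −h + 1/2 if h ≥ 1, b_h = h + 1/2. Then τ and τ' are continuous on (a_h, b_h), but τ'' is discontinuous at v = 0. -/

import Mathlib

/-- The binary entropy `H(p) = -p ln p - (1-p) ln(1-p)`. -/
noncomputable def Hent (p : ℝ) : ℝ := -p * Real.log p - (1 - p) * Real.log (1 - p)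

/-- `p_v = ((2v + h²)^{1/2} - h + 1)/2`. -/
noncomputable def pv (h v : ℝ) : ℝ := (Real.sqrt (2 * v + h ^ 2) - h + 1) / 2

/-- The growth rate `τ(v)`: `H(p_v)` for `v ≤ 0`, and `ln 2` for `v ≥ 0`. -/
noncomputable def tauF (h v : ℝ) : ℝ := if v ≤ 0 then Hent (pv h v) else Real.log 2

/-- The left endpoint `a_h` of the energy interval. -/
noncomputable def aEnd (h : ℝ) : ℝ := if h ≤ 1 then -h ^ 2 / 2 else -h + 1 / 2

/-- The derivative of `Hent ∘ pv`. -/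
noncomputable def DD (h v : ℝ) : ℝ :=
  (Real.log (1 - pv h v) - Real.log (pv h v)) * (1 / (2 * Real.sqrt (2 * v + h ^ 2)))

/-- The derivative of `tauF`. -/
noncomputable def GG (h v : ℝ) : ℝ := if v ≤ 0 then DD h v else 0

lemma rad_pos (h : ℝ) (v : ℝ) (hv : aEnd h < v) : 0 < 2 * v + h ^ 2 := by
  unfold aEnd at hv
  split_ifs at hv with h1
  · linarith
  · nlinarith [sq_nonneg (h - 1)]

lemma pv_pos (h : ℝ) (v : ℝ) (hv : aEnd h < v) : 0 < pv h v := by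
  have h0 := rad_pos h v hv
  have hs := Real.sqrt_pos.mpr h0
  unfold aEnd at hv
  unfold pv
  split_ifs at hv with h1
  · linarith
  · have : h - 1 < Real.sqrt (2 * v + h ^ 2) := by
      apply Real.lt_sqrt_of_sq_lt
      nlinarith
    linarith

lemma pv_le (h : ℝ) (hh : 0 < h) (v : ℝ) (hv : v ≤ 0) : pv h v ≤ 1 / 2 := by
  have : Real.sqrt (2 * v + h ^ 2) ≤ h := by
    apply Real.sqrt_le_iff.mpr
    exact ⟨hh.le, by linarith⟩
  unfold pv
  linarith

lemma pv_zero (h : ℝ) (hh : 0 < h) : pv h 0 = 1 / 2 := by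
  have : Real.sqrt (2 * 0 + h ^ 2) = h := by
    rw [mul_zero, zero_add, Real.sqrt_sq hh.le]
  unfold pv
  rw [this]; ring

lemma aEnd_neg (h : ℝ) (hh : 0 < h) : aEnd h < 0 := by
  unfold aEnd
  split_ifs with h1
  · have : 0 < h ^ 2 := by positivity
    linarith
  · linarith

lemma sqrt_deriv (h v : ℝ) (h0 : 0 < 2 * v + h ^ 2) :
    HasDerivAt (fun v => Real.sqrt (2 * v + h ^ 2)) (1 / Real.sqrt (2 * v + h ^ 2)) v := by
  have h1 : HasDerivAt (fun v : ℝ => 2 * v + h ^ 2) 2 v := by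
    simpa using ((hasDerivAt_id v).const_mul 2).add_const (h ^ 2)
  have h2 := h1.sqrt h0.ne'
  have hs := Real.sqrt_pos.mpr h0
  convert h2 using 1
  field_simp

lemma pv_deriv (h v : ℝ) (h0 : 0 < 2 * v + h ^ 2) :
    HasDerivAt (pv h) (1 / (2 * Real.sqrt (2 * v + h ^ 2))) v := by
  have h2 := (((sqrt_deriv h v h0).sub_const h).add_const 1).div_const 2
  have hs := Real.sqrt_pos.mpr h0
  unfold pv
  refine HasDerivAt.congr_deriv h2 ?_
  field_simp

lemma Hpv_deriv (h v : ℝ) (h0 : 0 < 2 * v + h ^ 2) (hp : pv h v ≠ 0) (hq : 1 - pv h v ≠ 0) :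
    HasDerivAt (fun v => Hent (pv h v)) (DD h v) v := by
  have hp1 := pv_deriv h v h0
  have hq1 := hp1.const_sub 1
  have := (hp1.neg.mul (hp1.log hp)).sub (hq1.mul (hq1.log hq))
  have hs := Real.sqrt_pos.mpr h0
  unfold Hent DD
  refine HasDerivAt.congr_deriv this ?_
  simp only [Pi.neg_apply]
  field_simp
  ring

lemma DD_deriv (h v : ℝ) (h0 : 0 < 2 * v + h ^ 2) (hp : pv h v ≠ 0) (hq : 1 - pv h v ≠ 0) :
    ∃ d, HasDerivAt (DD h) d v ∧ (0 < h → v = 0 → d = - 1 / h ^ 2) := by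
  have hp1 := pv_deriv h v h0
  have hq1 := hp1.const_sub 1
  have hs := Real.sqrt_pos.mpr h0
  have h3 := ((hasDerivAt_const v (1:ℝ)).div ((sqrt_deriv h v h0).const_mul 2)
    (by positivity))
  have := ((hq1.log hq).sub (hp1.log hp)).mul h3
  refine ⟨_, this, ?_⟩
  rintro hh rfl
  have e : Real.sqrt (2 * 0 + h ^ 2) = h := by
    rw [mul_zero, zero_add, Real.sqrt_sq hh.le]
  simp only [pv_zero h hh, e, Pi.sub_apply, Pi.div_apply]
  norm_num
  field_simp
  norm_num

lemma DD_zero (h : ℝ) (hh : 0 < h) : DD h 0 = 0 := by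
  unfold DD
  rw [pv_zero h hh]
  norm_num

lemma tau_deriv (h : ℝ) (hh : 0 < h) (v : ℝ) (hv : aEnd h < v) :
    HasDerivAt (tauF h) (GG h v) v := by
  have h0 := rad_pos h v hv
  have hp := pv_pos h v hv
  rcases lt_trichotomy v 0 with h1 | h1 | h1
  · have hq := pv_le h hh v h1.le
    have := Hpv_deriv h v h0 hp.ne' (by linarith)
    rw [GG, if_pos h1.le]
    apply this.congr_of_eventuallyEq
    filter_upwards [Iio_mem_nhds h1] with w hw
    rw [tauF, if_pos (le_of_lt hw)]
  · subst h1
    have hq := pv_le h hh 0 le_rfl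
    have := Hpv_deriv h 0 h0 hp.ne' (by linarith)
    rw [GG, if_pos le_rfl]
    have hval : Hent (pv h 0) = Real.log 2 := by
      rw [pv_zero h hh, Hent]
      norm_num
      rw [Real.log_div (by norm_num) (by norm_num), Real.log_one]
      ring
    have hL : HasDerivWithinAt (tauF h) (DD h 0) (Set.Iic 0) 0 := by
      apply this.hasDerivWithinAt.congr
      · intro w hw
        rw [tauF, if_pos (Set.mem_Iic.mp hw)]
      · rw [tauF, if_pos le_rfl]
    have hR : HasDerivWithinAt (tauF h) (DD h 0) (Set.Ici 0) 0 := by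
      rw [DD_zero h hh]
      apply (hasDerivWithinAt_const (0:ℝ) (Set.Ici 0) (Real.log 2)).congr
      · intro w hw
        rw [tauF]
        split_ifs with h2
        · have : w = 0 := le_antisymm h2 hw
          rw [this, hval]
        · rfl
      · rw [tauF, if_pos le_rfl, hval]
    have := hL.union hR
    rw [Set.Iic_union_Ici] at this
    exact hasDerivWithinAt_univ.mp this
  · rw [GG, if_neg (not_le.mpr h1)]
    apply (hasDerivAt_const v (Real.log 2)).congr_of_eventuallyEq
    filter_upwards [Ioi_mem_nhds h1] with w hw
    rw [tauF, if_neg (not_le.mpr hw)]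

lemma GG_cont (h : ℝ) (hh : 0 < h) : ContinuousOn (GG h) (Set.Ioi (aEnd h)) := by
  unfold GG
  apply ContinuousOn.if
  · rintro a ⟨_, ha⟩
    have : a = 0 := by
      have := frontier_le_subset_eq continuous_id continuous_const ha
      simpa using this
    rw [this, DD_zero h hh]
  · rintro v ⟨hv, hv2⟩
    have hv0 : v ≤ 0 := by
      have : closure {a : ℝ | a ≤ 0} = {a : ℝ | a ≤ 0} := isClosed_Iic.closure_eq
      rw [this] at hv2
      exact hv2
    have hq := pv_le h hh v hv0
    obtain ⟨d, hd, _⟩ := DD_deriv h v (rad_pos h v hv) (pv_pos h v hv).ne' (by linarith)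
    exact hd.continuousAt.continuousWithinAt
  · exact continuousOn_const

theorem stmt15 (h : ℝ) (hh : 0 < h) :
    ContinuousOn (tauF h) (Set.Ioo (aEnd h) (h + 1 / 2)) ∧
    ContinuousOn (deriv (tauF h)) (Set.Ioo (aEnd h) (h + 1 / 2)) ∧
    ¬ ContinuousAt (deriv (deriv (tauF h))) 0 := by
  have ha := aEnd_neg h hh
  have hG : Set.EqOn (deriv (tauF h)) (GG h) (Set.Ioi (aEnd h)) := fun v hv =>
    (tau_deriv h hh v hv).deriv
  have hC : ContinuousOn (deriv (tauF h)) (Set.Ioi (aEnd h)) := (GG_cont h hh).congr hG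
  refine ⟨fun v hv => (tau_deriv h hh v hv.1).continuousAt.continuousWithinAt,
    hC.mono fun v hv => hv.1, fun hcont => ?_⟩
  have hright : ∀ v : ℝ, 0 < v → deriv (deriv (tauF h)) v = 0 := by
    intro v hv
    have : deriv (tauF h) =ᶠ[nhds v] fun _ => 0 := by
      filter_upwards [Ioi_mem_nhds hv] with w hw
      rw [hG (show aEnd h < w from ha.trans hw), GG, if_neg (not_le.mpr hw)]
    rw [this.deriv_eq]
    simp
  have hz : deriv (deriv (tauF h)) 0 = 0 := by
    have h1 : Filter.Tendsto (deriv (deriv (tauF h))) (nhdsWithin 0 (Set.Ioi 0))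
        (nhds (deriv (deriv (tauF h)) 0)) := hcont.tendsto.mono_left nhdsWithin_le_nhds
    have h2 : Filter.Tendsto (deriv (deriv (tauF h))) (nhdsWithin 0 (Set.Ioi 0)) (nhds 0) := by
      apply tendsto_const_nhds.congr'
      filter_upwards [self_mem_nhdsWithin] with v hv
      exact (hright v hv).symm
    exact tendsto_nhds_unique h1 h2
  have hleft : HasDerivWithinAt (deriv (tauF h)) 0 (Set.Iic 0) 0 := by
    apply hasDerivWithinAt_Iic_of_tendsto_deriv (s := Set.Ioo (aEnd h) 0)
    · rintro v ⟨hv, hv0⟩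
      have hq := pv_le h hh v hv0.le
      obtain ⟨d, hd, _⟩ := DD_deriv h v (rad_pos h v hv) (pv_pos h v hv).ne' (by linarith)
      have : deriv (tauF h) =ᶠ[nhds v] DD h := by
        filter_upwards [Ioo_mem_nhds hv hv0] with w hw
        rw [hG hw.1, GG, if_pos hw.2.le]
      exact (hd.congr_of_eventuallyEq this).differentiableAt.differentiableWithinAt
    · exact (hC.continuousAt (Ioi_mem_nhds ha)).continuousWithinAt
    · exact Ioo_mem_nhdsLT ha
    · have := hcont.tendsto.mono_left (nhdsWithin_le_nhds (s := Set.Iio 0))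
      rwa [hz] at this
  have hq := pv_le h hh 0 le_rfl
  obtain ⟨d, hd, hd2⟩ := DD_deriv h 0 (rad_pos h 0 ha) (pv_pos h 0 ha).ne' (by linarith)
  have hD : HasDerivWithinAt (deriv (tauF h)) d (Set.Iic 0) 0 := by
    apply hd.hasDerivWithinAt.congr_of_eventuallyEq
    · filter_upwards [self_mem_nhdsWithin, mem_nhdsWithin_of_mem_nhds (Ioi_mem_nhds ha)]
        with w hw hw2
      rw [hG hw2, GG, if_pos (Set.mem_Iic.mp hw)]
    · rw [hG ha, GG, if_pos le_rfl]
  have heq := (uniqueDiffOn_Iic (0:ℝ) 0 Set.self_mem_Iic).eq_deriv _ hleft hD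
  rw [hd2 hh rfl] at heq
  have : 0 < 1 / h ^ 2 := by positivity
  rw [neg_div] at heq
  linarith
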